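/- arXiv:1305.3035 — 2 statements merged into one kernel-verified Lean document; each statement's English description precedes it below -/
import Mathlib

section
/- Let d = 2 and M ≥ 11 be integers, and set m = ⌈M/4⌉. Then for all integers k ≥ 1 and t ≥ 1: if 1 ≤ t ≤ m - 1 then G(t + M, k) ≤ (9/10) · G(t, k), and if t ≥ m then G(t + M, k) ≤ (9/10)^2 · G(t, k). -/
/-- The vertices of the rooted `d`-ary tree of depth `k`: sequences over `Fin d`
of length at most `k`.  The root is the empty sequence, the children of a vertex
`l` with `l.length < k` are the vertices `l ++ [j]` for `j : Fin d`, and the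
leaves are the vertices of length exactly `k`. -/
abbrev Vtx (d k : ℕ) : Type := {l : List (Fin d) // l.length ≤ k}

/-- The root `v₀` of the tree. -/
def rootV (d k : ℕ) : Vtx d k := ⟨[], by simp⟩

/-- `L_M(d,k)`: the set of integer-valued `M`-Lipschitz functions on the
`d`-ary tree of depth `k` that vanish on all leaves. -/
def LM (d k M : ℕ) : Set (Vtx d k → ℤ) :=
  {f | (∀ v : Vtx d k, v.1.length = k → f v = 0) ∧
       (∀ (l : List (Fin d)) (hl : l.length + 1 ≤ k) (j : Fin d),
         |f ⟨l ++ [j], by simpa using hl⟩ - f ⟨l, Nat.le_of_succ_le hl⟩| ≤ (M : ℤ))}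

/-- `G(t,k)`: the number of functions in `L_M(d,k)` whose value at the root is `t`. -/
noncomputable def G (d k M : ℕ) (t : ℤ) : ℕ :=
  Nat.card {f : Vtx d k → ℤ // f ∈ LM d k M ∧ f (rootV d k) = t}

/-- The probability that a uniformly random element of `L_M(d,k)` takes the
value `t` at the root. -/
noncomputable def PrRoot (d k M : ℕ) (t : ℤ) : ℝ :=
  (G d k M t : ℝ) / (Nat.card (LM d k M) : ℝ)

/-- The restriction of a function on `T(d,k+1)` to the subtree below the `i`-th child of the root. -/
def subtreeFn {d k : ℕ} (f : Vtx d (k + 1) → ℤ) (i : Fin d) : Vtx d k → ℤ :=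
  fun v => f ⟨i :: v.1, by simpa using v.2⟩

/-- The function on `T(d,k+1)` with root value `t` and prescribed restrictions to the subtrees
below the root. -/
def glueFn {d k : ℕ} (t : ℤ) (h : Fin d → Vtx d k → ℤ) : Vtx d (k + 1) → ℤ
  | ⟨[], _⟩ => t
  | ⟨i :: l, hl⟩ => h i ⟨l, by simpa using hl⟩

theorem subtreeFn_mem_LM {d k M : ℕ} {f : Vtx d (k + 1) → ℤ} (hf : f ∈ LM d (k + 1) M)
    (i : Fin d) : subtreeFn f i ∈ LM d k M := by
  refine ⟨fun v hv => hf.1 _ (by simpa using hv), fun l hl j => ?_⟩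
  exact hf.2 (i :: l) (by simpa using hl) j

theorem abs_subtreeFn_root_sub_le {d k M : ℕ} {f : Vtx d (k + 1) → ℤ}
    (hf : f ∈ LM d (k + 1) M) (i : Fin d) :
    |subtreeFn f i (rootV d k) - f (rootV d (k + 1))| ≤ (M : ℤ) :=
  hf.2 [] (by simp) i

theorem glueFn_mem_LM {d k M : ℕ} {t : ℤ} {h : Fin d → Vtx d k → ℤ}
    (hL : ∀ i, h i ∈ LM d k M) (hr : ∀ i, |h i (rootV d k) - t| ≤ (M : ℤ)) :
    glueFn t h ∈ LM d (k + 1) M := by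
  refine ⟨?_, ?_⟩
  · rintro ⟨l, hl⟩ hv
    cases l with
    | nil => simp at hv
    | cons i l => exact (hL i).1 _ (by simpa using hv)
  · intro l hl j
    cases l with
    | nil => exact hr j
    | cons i l => exact (hL i).2 l (by simpa using hl) j

/-- A Lipschitz function with root value `t` amounts to a choice of Lipschitz functions on the
subtrees whose root values are within `M` of `t`. -/
def rootFiberEquiv (d k M : ℕ) (t : ℤ) :
    {f : Vtx d (k + 1) → ℤ // f ∈ LM d (k + 1) M ∧ f (rootV d (k + 1)) = t} ≃
      (Fin d → {h : Vtx d k → ℤ // h ∈ LM d k M ∧ |h (rootV d k) - t| ≤ (M : ℤ)}) where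
  toFun f i := ⟨subtreeFn f.1 i, subtreeFn_mem_LM f.2.1 i, by
    have := abs_subtreeFn_root_sub_le f.2.1 i
    rwa [f.2.2] at this⟩
  invFun h := ⟨glueFn t fun i => (h i).1,
    glueFn_mem_LM (fun i => (h i).2.1) (fun i => (h i).2.2), rfl⟩
  left_inv f := by
    apply Subtype.ext
    funext v
    obtain ⟨l, hl⟩ := v
    cases l with
    | nil => exact f.2.2.symm
    | cons i l => rfl
  right_inv h := rfl

/-- Lipschitz functions with root value within `M` of `t`, sorted by root value. -/
def nearFiberEquiv (d k M : ℕ) (t : ℤ) :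
    {h : Vtx d k → ℤ // h ∈ LM d k M ∧ |h (rootV d k) - t| ≤ (M : ℤ)} ≃
      Σ s : Finset.Icc (t - M) (t + M),
        {f : Vtx d k → ℤ // f ∈ LM d k M ∧ f (rootV d k) = (s : ℤ)} where
  toFun h := ⟨⟨h.1 (rootV d k), by
    have := abs_le.1 h.2.2
    rw [Finset.mem_Icc]
    constructor <;> linarith⟩, h.1, h.2.1, rfl⟩
  invFun p := ⟨p.2.1, p.2.2.1, by
    have := Finset.mem_Icc.1 p.1.2
    rw [p.2.2.2, abs_le]
    constructor <;> linarith⟩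
  left_inv h := rfl
  right_inv := by
    rintro ⟨⟨s, hs⟩, f, hf, h⟩
    dsimp only at h
    subst h
    rfl

theorem finite_rootFiber (d k M : ℕ) (t : ℤ) :
    Finite {f : Vtx d k → ℤ // f ∈ LM d k M ∧ f (rootV d k) = t} := by
  induction k generalizing t with
  | zero =>
    refine @Finite.of_subsingleton _ ⟨fun f g => Subtype.ext (funext fun v => ?_)⟩
    have hv : v.1.length = 0 := Nat.le_zero.1 v.2
    rw [f.2.1.1 v hv, g.2.1.1 v hv]
  | succ k ih =>
    have : Finite (Σ s : Finset.Icc (t - M) (t + M),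
        {f : Vtx d k → ℤ // f ∈ LM d k M ∧ f (rootV d k) = (s : ℤ)}) := inferInstance
    have := Finite.of_equiv _ (nearFiberEquiv d k M t).symm
    exact Finite.of_equiv _ (rootFiberEquiv d k M t).symm

theorem G_succ (d k M : ℕ) (t : ℤ) :
    G d (k + 1) M t = (∑ s ∈ Finset.Icc (t - M) (t + M), G d k M s) ^ d := by
  have := fun s => finite_rootFiber d k M s
  rw [G, Nat.card_congr (rootFiberEquiv d k M t), Nat.card_fun, Nat.card_fin,
    Nat.card_congr (nearFiberEquiv d k M t), Nat.card_sigma]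
  exact congrArg (· ^ d) (Finset.sum_coe_sort (Finset.Icc (t - (M : ℤ)) (t + M)) fun s => G d k M s)

theorem G_zero (d M : ℕ) (t : ℤ) : G d 0 M t = if t = 0 then 1 else 0 := by
  have key : ∀ f : Vtx d 0 → ℤ, f ∈ LM d 0 M → f = fun _ => 0 := fun f hf =>
    funext fun v => hf.1 v (Nat.le_zero.1 v.2)
  split_ifs with ht
  · subst ht
    rw [G, Nat.card_eq_one_iff_unique]
    refine ⟨⟨fun f g => Subtype.ext ((key _ f.2.1).trans (key _ g.2.1).symm)⟩,
      ⟨fun _ => 0, ⟨fun _ _ => rfl, fun l hl => by simp at hl⟩, rfl⟩⟩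
  · rw [G, Nat.card_eq_zero]
    refine Or.inl ⟨fun f => ht ?_⟩
    rw [← f.2.2, key _ f.2.1]

theorem sum_Icc_split {g : ℤ → ℝ} {a b c : ℤ} (hab : a ≤ b + 1) (hbc : b ≤ c) :
    ∑ s ∈ Finset.Icc a c, g s = ∑ s ∈ Finset.Icc a b, g s + ∑ s ∈ Finset.Icc (b + 1) c, g s := by
  rw [← Finset.sum_union]
  · congr 1
    ext x
    simp only [Finset.mem_union, Finset.mem_Icc]
    omega
  · rw [Finset.disjoint_left]
    intro x
    simp only [Finset.mem_Icc]
    omega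

theorem sum_Icc_neg (g : ℤ → ℝ) (a b : ℤ) :
    ∑ s ∈ Finset.Icc (-b) (-a), g s = ∑ s ∈ Finset.Icc a b, g (-s) := by
  refine Finset.sum_nbij' (fun s => -s) (fun s => -s) ?_ ?_ ?_ ?_ ?_ <;>
    simp only [Finset.mem_Icc, neg_neg, implies_true] <;> intros <;> omega

theorem sum_Icc_shift_le {g : ℤ → ℝ} {a b a' b' e : ℤ} {c : ℝ} (ha : a' = a + e) (hb : b' = b + e)
    (h : ∀ s, a ≤ s → s ≤ b → g (s + e) ≤ c * g s) :
    ∑ s ∈ Finset.Icc a' b', g s ≤ c * ∑ s ∈ Finset.Icc a b, g s := by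
  subst ha hb
  rw [Finset.mul_sum, ← Finset.map_add_right_Icc, Finset.sum_map]
  exact Finset.sum_le_sum fun s hs => h s (Finset.mem_Icc.1 hs).1 (Finset.mem_Icc.1 hs).2

theorem sum_Icc_le_mul {g : ℤ → ℝ} {a b : ℤ} {c : ℝ} (hab : a ≤ b + 1)
    (h : ∀ s, a ≤ s → s ≤ b → g s ≤ c) :
    ∑ s ∈ Finset.Icc a b, g s ≤ (b + 1 - a) * c := by
  have := Finset.sum_le_card_nsmul (Finset.Icc a b) g c fun s hs =>
    h s (Finset.mem_Icc.1 hs).1 (Finset.mem_Icc.1 hs).2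
  have hc : (((b + 1 - a).toNat : ℕ) : ℝ) = b + 1 - a := by
    have : (((b + 1 - a).toNat : ℕ) : ℤ) = b + 1 - a := Int.toNat_of_nonneg (by omega)
    exact_mod_cast this
  rwa [Int.card_Icc, nsmul_eq_mul, hc] at this

theorem mul_le_sum_Icc {g : ℤ → ℝ} {a b : ℤ} {c : ℝ} (hab : a ≤ b + 1)
    (h : ∀ s, a ≤ s → s ≤ b → c ≤ g s) :
    (b + 1 - a) * c ≤ ∑ s ∈ Finset.Icc a b, g s := by
  have := sum_Icc_le_mul (g := fun s => -g s) (c := -c) hab fun s h1 h2 => neg_le_neg (h s h1 h2)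
  rw [Finset.sum_neg_distrib] at this
  linarith

/-- The sum of `g` over the window of radius `M` around `t`. -/
noncomputable def windowSum (M : ℕ) (g : ℤ → ℝ) (t : ℤ) : ℝ := ∑ s ∈ Finset.Icc (t - M) (t + M), g s

/-- `g` is even and nonincreasing away from the origin. -/
def AbsAntitone (g : ℤ → ℝ) : Prop := ∀ a b : ℤ, |a| ≤ |b| → g b ≤ g a

theorem AbsAntitone.neg {g : ℤ → ℝ} (hg : AbsAntitone g) (a : ℤ) : g (-a) = g a :=
  le_antisymm (hg _ _ (by simp)) (hg _ _ (by simp))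

theorem AbsAntitone.le {g : ℤ → ℝ} (hg : AbsAntitone g) {a b : ℤ} (ha : 0 ≤ a) (hab : a ≤ b) :
    g b ≤ g a :=
  hg _ _ (by rwa [abs_of_nonneg ha, abs_of_nonneg (ha.trans hab)])

theorem AbsAntitone.sum_neg {g : ℤ → ℝ} (hg : AbsAntitone g) (a b : ℤ) :
    ∑ s ∈ Finset.Icc (-b) (-a), g s = ∑ s ∈ Finset.Icc a b, g s := by
  simp only [sum_Icc_neg, hg.neg]

theorem AbsAntitone.windowSum_succ_le {M : ℕ} {g : ℤ → ℝ} (hg : AbsAntitone g) {t : ℤ}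
    (ht : 0 ≤ t) : windowSum M g (t + 1) ≤ windowSum M g t := by
  have h1 := sum_Icc_split (g := g) (a := t - M) (b := t - M) (c := t + M + 1)
    (by omega) (by omega)
  have h2 := sum_Icc_split (g := g) (a := t - M) (b := t + M) (c := t + M + 1)
    (by omega) (by omega)
  have h3 : g (t + M + 1) ≤ g (t - M) := hg _ _ (by
    rw [abs_le, abs_of_nonneg (by omega : 0 ≤ t + M + 1)]
    omega)
  simp only [Finset.Icc_self, Finset.sum_singleton] at h1 h2
  rw [windowSum, windowSum, show t + 1 - (M : ℤ) = t - M + 1 by ring,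
    show t + 1 + (M : ℤ) = t + M + 1 by ring]
  linarith

theorem AbsAntitone.windowSum {M : ℕ} {g : ℤ → ℝ} (hg : AbsAntitone g) :
    AbsAntitone (windowSum M g) := by
  have hneg : ∀ t, _root_.windowSum M g (-t) = _root_.windowSum M g t := fun t => by
    rw [_root_.windowSum, _root_.windowSum, ← hg.sum_neg]
    congr 2 <;> ring
  have habs : ∀ t, _root_.windowSum M g |t| = _root_.windowSum M g t := fun t => by
    rcases abs_choice t with h | h <;> rw [h]
    exact hneg t
  intro a b hab
  rw [← habs a, ← habs b]
  refine Int.leInduction (motive := fun n _ =>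
    _root_.windowSum M g n ≤ _root_.windowSum M g |a|) le_rfl (fun n hn ih => ?_) |b| hab
  exact (hg.windowSum_succ_le ((abs_nonneg a).trans hn)).trans ih

theorem windowSum_nonneg {M : ℕ} {g : ℤ → ℝ} (h0 : ∀ s, 0 ≤ g s) (t : ℤ) :
    0 ≤ windowSum M g t :=
  Finset.sum_nonneg fun s _ => h0 s

/-- The window around `0` is at most twice as heavy as the window around any `t ∈ [0, M]`. -/
theorem AbsAntitone.windowSum_zero_le {M : ℕ} {g : ℤ → ℝ} (hg : AbsAntitone g)
    (h0 : ∀ s, 0 ≤ g s) {t : ℤ} (ht : 0 ≤ t) (htM : t ≤ M) :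
    _root_.windowSum M g 0 ≤ 2 * _root_.windowSum M g t := by
  have h1 := sum_Icc_split (g := g) (a := -(M : ℤ)) (b := -1) (c := M) (by omega) (by omega)
  have h2 := hg.sum_neg 1 M
  have hsub : ∀ a : ℤ, 0 ≤ a → ∑ s ∈ Finset.Icc a M, g s ≤ _root_.windowSum M g t := fun a ha =>
    Finset.sum_le_sum_of_subset_of_nonneg (Finset.Icc_subset_Icc (by omega) (by omega))
      fun s _ _ => h0 s
  have h3 := hsub 0 le_rfl
  have h4 := hsub 1 (by norm_num)
  rw [show (-1 : ℤ) + 1 = 0 by norm_num] at h1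
  rw [_root_.windowSum, zero_sub, zero_add, h1, h2]
  linarith

section Decay

variable {M : ℕ} {g : ℤ → ℝ} {m t : ℤ}

theorem windowSum_add_le_of_lt (h1 : ∀ s, 1 ≤ s → g (s + M) ≤ 9 / 10 * g s) (ht : (M : ℤ) < t) :
    windowSum M g (t + M) ≤ 9 / 10 * windowSum M g t :=
  sum_Icc_shift_le (e := M) (by ring) (by ring) fun s hs _ => h1 s (by omega)

/-- For `1 ≤ t ≤ M`, the window around `t`, folded onto the nonnegative integers. -/
theorem AbsAntitone.windowSum_eq (hg : AbsAntitone g) (ht : 1 ≤ t) (htM : t ≤ M) :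
    _root_.windowSum M g t = g 0 + ∑ s ∈ Finset.Icc 1 (M - t), g s + ∑ s ∈ Finset.Icc 1 t, g s +
      ∑ s ∈ Finset.Icc (t + 1) M, g s + ∑ s ∈ Finset.Icc (M + 1 : ℤ) (M + t), g s := by
  have e1 := sum_Icc_split (g := g) (a := t - M) (b := -1) (c := t + M) (by omega) (by omega)
  have e2 := sum_Icc_split (g := g) (a := 0) (b := 0) (c := t + M) (by omega) (by omega)
  have e3 := sum_Icc_split (g := g) (a := 1) (b := t) (c := t + M) (by omega) (by omega)
  have e4 := sum_Icc_split (g := g) (a := t + 1) (b := M) (c := t + M) (by omega) (by omega)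
  have e5 := hg.sum_neg 1 (M - t)
  simp only [Finset.Icc_self, Finset.sum_singleton, neg_add_cancel, zero_add, neg_sub] at e1 e2 e5
  rw [_root_.windowSum, e1, e2, e3, e4, e5, add_comm t (M : ℤ)]
  ring

theorem windowSum_add_eq (ht : 1 ≤ t) (htM : t ≤ M) :
    windowSum M g (t + M) = g t + ∑ s ∈ Finset.Icc (t + 1) M, g s +
      ∑ s ∈ Finset.Icc (M + 1 : ℤ) (M + t), g s +
      ∑ s ∈ Finset.Icc (M + t + 1 : ℤ) (M + M), g s +
      ∑ s ∈ Finset.Icc (M + M + 1 : ℤ) (M + M + t), g s := by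
  have e1 := sum_Icc_split (g := g) (a := t) (b := t) (c := M + M + t) (by omega) (by omega)
  have e2 := sum_Icc_split (g := g) (a := t + 1) (b := M) (c := M + M + t) (by omega) (by omega)
  have e3 := sum_Icc_split (g := g) (a := M + 1) (b := M + t) (c := M + M + t)
    (by omega) (by omega)
  have e4 := sum_Icc_split (g := g) (a := M + t + 1) (b := M + M) (c := M + M + t)
    (by omega) (by omega)
  simp only [Finset.Icc_self, Finset.sum_singleton] at e1
  rw [windowSum, show t + (M : ℤ) - M = t by ring, show t + (M : ℤ) + M = M + M + t by ring,
    e1, e2, e3, e4]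
  ring

theorem AbsAntitone.windowSum_add_le_of_le (hg : AbsAntitone g) (h0 : ∀ s, 0 ≤ g s)
    (hm3 : 3 ≤ m) (hm : (M : ℤ) ≤ 4 * m)
    (h1 : ∀ s, 1 ≤ s → g (s + M) ≤ 9 / 10 * g s)
    (h2 : ∀ s, m ≤ s → g (s + M) ≤ (9 / 10) ^ 2 * g s) (ht : m ≤ t) (htM : t ≤ M) :
    _root_.windowSum M g (t + M) ≤ 9 / 10 * _root_.windowSum M g t := by
  rw [hg.windowSum_eq (by omega) htM, windowSum_add_eq (by omega) htM]
  have b1 : ∑ s ∈ Finset.Icc (M + 1 : ℤ) (M + t), g s ≤ 9 / 10 * ∑ s ∈ Finset.Icc 1 t, g s :=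
    sum_Icc_shift_le (e := M) (by ring) (by ring) fun s hs _ => h1 s hs
  have b2 : ∑ s ∈ Finset.Icc (M + t + 1 : ℤ) (M + M), g s ≤
      (9 / 10) ^ 2 * ∑ s ∈ Finset.Icc (t + 1) M, g s :=
    sum_Icc_shift_le (e := M) (by ring) (by ring) fun s hs _ => h2 s (by omega)
  have b3 : ∑ s ∈ Finset.Icc (M + M + 1 : ℤ) (M + M + t), g s ≤
      (9 / 10) ^ 2 * ∑ s ∈ Finset.Icc (M + 1 : ℤ) (M + t), g s :=
    sum_Icc_shift_le (e := M) (by ring) (by ring) fun s hs _ => h2 s (by omega)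
  have b4 : ∑ s ∈ Finset.Icc (t + 1) M, g s ≤ 1 * ∑ s ∈ Finset.Icc 1 (M - t), g s :=
    sum_Icc_shift_le (e := t) (by ring) (by ring) fun s hs _ => by
      rw [one_mul]; exact hg.le (by omega) (by omega)
  have b5 : ∑ s ∈ Finset.Icc (t + 1) M, g s ≤ (M + 1 - (t + 1 : ℤ)) * g t := by
    exact_mod_cast sum_Icc_le_mul (a := t + 1) (b := M) (c := g t) (by omega)
      fun s hs _ => hg.le (by omega) (by omega)
  have b6 : (t + 1 - (1 : ℤ)) * g t ≤ ∑ s ∈ Finset.Icc 1 t, g s :=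
    mul_le_sum_Icc (by omega) fun s hs hst => hg.le (by omega) (by omega)
  have b7 : g t ≤ g 0 := hg.le le_rfl (by omega)
  have b8 : (M : ℝ) * g t ≤ 4 * (t * g t) := by
    have : (M : ℝ) ≤ 4 * t := by exact_mod_cast hm.trans (by omega)
    nlinarith [h0 t]
  have b9 := h0 t
  have b10 : 3 * g t ≤ t * g t :=
    mul_le_mul_of_nonneg_right (by exact_mod_cast hm3.trans ht) (h0 t)
  push_cast at b5 b6
  linarith

theorem AbsAntitone.windowSum_add_le_of_lt (hg : AbsAntitone g) (h0 : ∀ s, 0 ≤ g s)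
    (hmM : 2 * m ≤ M + 2)
    (hq : ∀ s : ℤ, 0 ≤ s → s ≤ M → g 0 ≤ 4 * g s)
    (h1 : ∀ s, 1 ≤ s → g (s + M) ≤ 9 / 10 * g s)
    (h2 : ∀ s, m ≤ s → g (s + M) ≤ (9 / 10) ^ 2 * g s) (ht : 1 ≤ t) (htm : t < m)
    (hM : m ≤ M) :
    _root_.windowSum M g (t + M) ≤ 9486 / 10000 * _root_.windowSum M g t := by
  rw [hg.windowSum_eq ht (by omega), windowSum_add_eq ht (by omega)]
  have b1 : ∑ s ∈ Finset.Icc (M + 1 : ℤ) (M + t), g s ≤ 9 / 10 * ∑ s ∈ Finset.Icc 1 t, g s :=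
    sum_Icc_shift_le (e := M) (by ring) (by ring) fun s hs _ => h1 s hs
  have e1 := sum_Icc_split (g := g) (a := t + 1) (b := m - 1) (c := M) (by omega) (by omega)
  have e2 := sum_Icc_split (g := g) (a := M + t + 1) (b := M + m - 1) (c := M + M)
    (by omega) (by omega)
  rw [show m - 1 + 1 = m by ring] at e1
  rw [show (M : ℤ) + m - 1 + 1 = M + m by ring] at e2
  have b2 : ∑ s ∈ Finset.Icc (M + t + 1 : ℤ) (M + m - 1), g s ≤
      9 / 10 * ∑ s ∈ Finset.Icc (t + 1) (m - 1), g s :=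
    sum_Icc_shift_le (e := M) (by ring) (by ring) fun s hs _ => h1 s (by omega)
  have b3 : ∑ s ∈ Finset.Icc (M + m : ℤ) (M + M), g s ≤
      (9 / 10) ^ 2 * ∑ s ∈ Finset.Icc m M, g s :=
    sum_Icc_shift_le (e := M) (by ring) (by ring) fun s hs _ => h2 s (by omega)
  have b4 : ∑ s ∈ Finset.Icc (M + M + 1 : ℤ) (M + M + t), g s ≤
      (9 / 10) ^ 2 * ∑ s ∈ Finset.Icc (M + 1 : ℤ) (M + t), g s :=
    sum_Icc_shift_le (e := M) (by ring) (by ring) fun s hs _ => h2 s (by omega)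
  have e3 := sum_Icc_split (g := g) (a := 1) (b := M - t) (c := M) (by omega) (by omega)
  have e4 := sum_Icc_split (g := g) (a := 1) (b := t) (c := M) (by omega) (by omega)
  have b5 : ∑ s ∈ Finset.Icc (M - t + 1) M, g s ≤ 1 * ∑ s ∈ Finset.Icc 1 t, g s :=
    sum_Icc_shift_le (e := M - t) (by ring) (by ring) fun s hs _ => by
      rw [one_mul]; exact hg.le (by omega) (by omega)
  have b6 : ∑ s ∈ Finset.Icc (t + 1) (m - 1), g s ≤ ((m - 1 : ℤ) + 1 - (t + 1 : ℤ)) * g 0 :=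
    sum_Icc_le_mul (by omega) fun s hs _ => hg.le (by omega) (by omega)
  have b7 : (M + 1 - m) * (g 0 / 4) ≤ ∑ s ∈ Finset.Icc m M, g s := by
    exact_mod_cast mul_le_sum_Icc (a := m) (b := M) (c := g 0 / 4) (by omega)
      fun s hs hst => by linarith [hq s (by omega) hst]
  have b8 : (t + 1 - (1 : ℤ)) * g t ≤ ∑ s ∈ Finset.Icc 1 t, g s :=
    mul_le_sum_Icc (by omega) fun s hs hst => hg.le (by omega) (by omega)
  have b9 : g t ≤ g 0 := hg.le le_rfl (by omega)
  have b10 : g t ≤ t * g t := le_mul_of_one_le_left (h0 t) (by exact_mod_cast ht)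
  have b11 : ((m : ℝ) - 1 - t) * g 0 ≤ (M + 1 - m) * g 0 := by
    refine mul_le_mul_of_nonneg_right ?_ (h0 0)
    have : m - 1 - t ≤ M + 1 - m := by omega
    exact_mod_cast this
  have b12 := h0 t
  have b13 : 0 ≤ ∑ s ∈ Finset.Icc m M, g s := Finset.sum_nonneg fun s _ => h0 s
  push_cast at b6 b8
  linarith

end Decay

theorem G_two_succ (k M : ℕ) (t : ℤ) :
    (G 2 (k + 1) M t : ℝ) = windowSum M (fun s => (G 2 k M s : ℝ)) t ^ 2 := by
  rw [G_succ, windowSum]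
  push_cast
  rfl

theorem absAntitone_G_two (k M : ℕ) : AbsAntitone fun t => (G 2 k M t : ℝ) := by
  induction k with
  | zero =>
    intro a b hab
    simp only [G_zero]
    split_ifs with hb ha <;> simp_all
  | succ k ih =>
    intro a b hab
    simp only [G_two_succ]
    exact pow_le_pow_left₀ (windowSum_nonneg (fun _ => Nat.cast_nonneg _) b)
      (ih.windowSum a b hab) 2

theorem G_two_root_zero_le (k M : ℕ) {t : ℤ} (ht : 0 ≤ t) (htM : t ≤ M) :
    (G 2 (k + 1) M 0 : ℝ) ≤ 4 * G 2 (k + 1) M t := by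
  have h0 : ∀ s, 0 ≤ (G 2 k M s : ℝ) := fun _ => Nat.cast_nonneg _
  have h := pow_le_pow_left₀ (windowSum_nonneg h0 0)
    ((absAntitone_G_two k M).windowSum_zero_le h0 ht htM) 2
  rw [G_two_succ, G_two_succ]
  linarith

theorem G_two_one_eq_zero {M : ℕ} {t : ℤ} (ht : (M : ℤ) < t) : G 2 1 M t = 0 := by
  rw [G_succ, Finset.sum_eq_zero, zero_pow two_ne_zero]
  intro s hs
  have := Finset.mem_Icc.1 hs
  rw [G_zero, if_neg (by omega)]

/-- **Exponential decay, `d = 2`, strengthened induction statement.**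
Let `d = 2`, `M ≥ 11` and `m = ⌈M/4⌉`.  For all `k, t ≥ 1`:  if `t ≤ m - 1`
then `G(t+M,k) ≤ (9/10) * G(t,k)`, and if `t ≥ m` then
`G(t+M,k) ≤ (9/10)² * G(t,k)`. -/
theorem G_exp_decay_d_eq_two_strong (d M : ℕ) (hd : d = 2) (hM : 11 ≤ M)
    (m : ℤ) (hm : m = ⌈(M : ℚ) / 4⌉) (k : ℕ) (hk : 1 ≤ k) (t : ℤ) (ht : 1 ≤ t) :
    (t ≤ m - 1 → (G d k M (t + M) : ℝ) ≤ (9 / 10 : ℝ) * (G d k M t : ℝ)) ∧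
    (m ≤ t → (G d k M (t + M) : ℝ) ≤ (9 / 10 : ℝ) ^ 2 * (G d k M t : ℝ)) := by
  subst hd
  have hm3 : 3 ≤ m ∧ (M : ℤ) ≤ 4 * m ∧ 2 * m ≤ M + 2 ∧ m ≤ M := by
    have hlo := Int.le_ceil ((M : ℚ) / 4)
    have hhi := Int.ceil_lt_add_one ((M : ℚ) / 4)
    rw [← hm] at hlo hhi
    have hlo' : (M : ℤ) ≤ 4 * m := by
      have : (M : ℚ) ≤ 4 * m := by linarith
      exact_mod_cast this
    have hhi' : 4 * m < (M : ℤ) + 4 := by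
      have : 4 * (m : ℚ) < M + 4 := by linarith
      exact_mod_cast this
    omega
  obtain ⟨hm3, hm4, hm2, hmM⟩ := hm3
  induction k, hk using Nat.le_induction generalizing t with
  | base =>
    rw [G_two_one_eq_zero (by omega : (M : ℤ) < t + M)]
    constructor <;> intro _ <;> push_cast <;> positivity
  | succ k hk ih =>
    have hg := absAntitone_G_two k M
    have h0 : ∀ s, 0 ≤ (G 2 k M s : ℝ) := fun _ => Nat.cast_nonneg _
    have h2 : ∀ s, m ≤ s → (G 2 k M (s + M) : ℝ) ≤ (9 / 10) ^ 2 * G 2 k M s := fun s hs =>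
      (ih s (by omega)).2 hs
    have h1 : ∀ s, 1 ≤ s → (G 2 k M (s + M) : ℝ) ≤ 9 / 10 * G 2 k M s := fun s hs => by
      rcases lt_or_ge s m with h | h
      · exact (ih s hs).1 (by omega)
      · linarith [h2 s h, h0 s]
    have hq : ∀ s : ℤ, 0 ≤ s → s ≤ M → (G 2 k M 0 : ℝ) ≤ 4 * G 2 k M s := by
      obtain ⟨j, rfl⟩ := Nat.exists_eq_add_of_le' hk
      exact fun s => G_two_root_zero_le j M
    have hw := windowSum_nonneg (M := M) h0
    simp only [G_two_succ]
    constructor <;> intro htm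
    · have h := pow_le_pow_left₀ (hw _)
        (hg.windowSum_add_le_of_lt h0 hm2 hq h1 h2 ht (by omega : t < m) hmM) 2
      rw [mul_pow] at h
      linarith [sq_nonneg (windowSum M (fun s => (G 2 k M s : ℝ)) t)]
    · rw [← mul_pow]
      refine pow_le_pow_left₀ (hw _) ?_ 2
      rcases le_or_gt t M with htM | htM
      · exact hg.windowSum_add_le_of_le h0 hm3 hm4 h1 h2 htm htM
      · exact windowSum_add_le_of_lt h1 htM
end

section
/- Let d = 2 and M ≥ 1 be integers, and let α ∈ (0,1) be a real number satisfying ((1 + α + (1 - α + α²)/M) / (2 + 1/M))^d ≤ α. Then for all integers k ≥ 1 and t ≥ 1, G(t + M, k) ≤ α · G(t, k). -/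
/-- Functions in `L_M(d,k)` with value `t` at the root. -/
abbrev LMAt (d k M : ℕ) (t : ℤ) : Type :=
  {f : Vtx d k → ℤ // f ∈ LM d k M ∧ f (rootV d k) = t}

/-- The function on the tree of depth `k + 1` with root value `t` and given restrictions to the
subtrees below the root. -/
def glue {d k : ℕ} (t : ℤ) (p : Fin d → Vtx d k → ℤ) : Vtx d (k + 1) → ℤ
  | ⟨[], _⟩ => t
  | ⟨j :: l, h⟩ => p j ⟨l, by simpa using h⟩

/-- A function with root value `t` is the same as its restrictions to the subtrees below the
root. -/
def subtreeEquiv (d k M : ℕ) (t : ℤ) :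
    LMAt d (k + 1) M t ≃
      (Fin d → {h : Vtx d k → ℤ // h ∈ LM d k M ∧
        h (rootV d k) ∈ Finset.Icc (t - M) (t + M)}) where
  toFun f j := ⟨fun v => f.1 ⟨j :: v.1, by simpa using v.2⟩, by
    obtain ⟨f, ⟨hleaf, hlip⟩, hroot⟩ := f
    refine ⟨⟨fun v hv => hleaf _ (by simpa using hv), fun l hl i => ?_⟩, ?_⟩
    · exact hlip (j :: l) (by simpa using hl) i
    · have h := hlip [] (by simp) j
      have hroot' : f ⟨[], by simp⟩ = t := hroot
      rw [hroot', abs_le] at h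
      rw [Finset.mem_Icc]
      have e : f ⟨[] ++ [j], by simp⟩ = f ⟨j :: (rootV d k).1, by simp [rootV]⟩ := rfl
      rw [e] at h
      constructor <;> linarith [h.1, h.2]⟩
  invFun p := ⟨glue t fun j => (p j).1, by
    refine ⟨⟨?_, ?_⟩, rfl⟩
    · rintro ⟨_ | ⟨j, l⟩, hv⟩ h
      · simp at h
      · exact (p j).2.1.1 _ (by simpa using h)
    · rintro (_ | ⟨i, l⟩) hl j
      · have h := (p j).2.2
        rw [Finset.mem_Icc] at h
        change |(p j).1 (rootV d k) - t| ≤ (M : ℤ)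
        rw [abs_le]
        constructor <;> linarith [h.1, h.2]
      · exact (p i).2.1.2 l (by simpa using hl) j⟩
  left_inv f := by
    obtain ⟨f, hf, hroot⟩ := f
    apply Subtype.ext
    funext v
    rcases v with ⟨_ | ⟨j, l⟩, hv⟩
    · exact hroot.symm
    · rfl
  right_inv p := rfl

/-- Functions with root value in a finite set, sorted by that value. -/
def rootValueEquiv (d k M : ℕ) (S : Finset ℤ) :
    {h : Vtx d k → ℤ // h ∈ LM d k M ∧ h (rootV d k) ∈ S} ≃ Σ s : S, LMAt d k M s where
  toFun h := ⟨⟨h.1 (rootV d k), h.2.2⟩, ⟨h.1, h.2.1, rfl⟩⟩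
  invFun x := ⟨x.2.1, x.2.2.1, by rw [x.2.2.2]; exact x.1.2⟩
  left_inv _ := rfl
  right_inv := by
    rintro ⟨⟨s, hs⟩, ⟨h, hh, hroot⟩⟩
    change h (rootV d k) = s at hroot
    subst hroot
    rfl

/-- The recursively defined counts of `M`-Lipschitz functions with given root value. -/
noncomputable def rootCount (d M : ℕ) : ℕ → ℤ → ℕ
  | 0, t => if t = 0 then 1 else 0
  | k + 1, t => (∑ s ∈ Finset.Icc (t - M) (t + M), rootCount d M k s) ^ d

lemma eq_rootV_zero {d : ℕ} (v : Vtx d 0) : v = rootV d 0 :=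
  Subtype.ext (List.eq_nil_of_length_eq_zero (Nat.le_zero.mp v.2))

lemma finite_LMAt_and_card_eq (d M k : ℕ) (t : ℤ) :
    Finite (LMAt d k M t) ∧ Nat.card (LMAt d k M t) = rootCount d M k t := by
  induction k generalizing t with
  | zero =>
    have : Subsingleton (LMAt d 0 M t) := ⟨fun f g => Subtype.ext <| funext fun v => by
      rw [eq_rootV_zero v, f.2.2, g.2.2]⟩
    refine ⟨inferInstance, ?_⟩
    by_cases ht : t = 0
    · subst ht
      have : Nonempty (LMAt d 0 M 0) :=
        ⟨⟨fun _ => 0, ⟨fun _ _ => rfl, fun l hl => by omega⟩, rfl⟩⟩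
      simp [rootCount]
    · have : IsEmpty (LMAt d 0 M t) := ⟨fun f => ht (by rw [← f.2.2, f.2.1.1 _ rfl])⟩
      simp [rootCount, ht]
  | succ k ih =>
    have hfin : ∀ s, Finite (LMAt d k M s) := fun s => (ih s).1
    have e := (subtreeEquiv d k M t).trans
      ((Equiv.refl (Fin d)).arrowCongr (rootValueEquiv d k M (Finset.Icc (t - M) (t + M))))
    refine ⟨Finite.of_equiv _ e.symm, ?_⟩
    rw [Nat.card_congr e, Nat.card_fun, Nat.card_sigma, Nat.card_fin, rootCount]
    congr 1
    exact (Finset.sum_congr rfl fun s _ => (ih s.1).2).trans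
      (Finset.sum_coe_sort _ (rootCount d M k))

lemma G_eq_rootCount (d k M : ℕ) (t : ℤ) : G d k M t = rootCount d M k t :=
  (finite_LMAt_and_card_eq d M k t).2

lemma sum_Icc_eq_sum_range {R : Type*} [AddCommMonoid R] (g : ℤ → R) (a : ℤ) (n : ℕ) :
    ∑ s ∈ Finset.Icc a (a + n), g s = ∑ i ∈ Finset.range (n + 1), g (a + i) := by
  symm
  refine Finset.sum_bij (fun i _ => a + (i : ℤ)) ?_ ?_ ?_ ?_
  · intro i hi
    simp only [Finset.mem_range, Finset.mem_Icc] at *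
    omega
  · intro i _ j _ h
    omega
  · intro s hs
    rw [Finset.mem_Icc] at hs
    exact ⟨(s - a).toNat, by rw [Finset.mem_range]; omega, by omega⟩
  · exact fun _ _ => rfl

/-- Window sums of a function that decreases in the absolute value decrease in the absolute value
of the centre. -/
lemma sum_Icc_le_of_abs_le {M : ℕ} {g : ℤ → ℕ} (hg : ∀ s t : ℤ, |s| ≤ |t| → g t ≤ g s)
    {s t : ℤ} (hst : |s| ≤ |t|) :
    ∑ u ∈ Finset.Icc (t - M) (t + M), g u ≤ ∑ u ∈ Finset.Icc (s - M) (s + M), g u := by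
  have hneg : ∀ t : ℤ, ∑ u ∈ Finset.Icc (-t - M) (-t + M), g u =
      ∑ u ∈ Finset.Icc (t - M) (t + M), g u := by
    intro t
    refine Finset.sum_bij (fun u _ => -u) ?_ ?_ ?_ ?_
    · intro u hu
      rw [Finset.mem_Icc] at *
      omega
    · intro u _ v _ h
      omega
    · intro u hu
      rw [Finset.mem_Icc] at hu
      exact ⟨-u, by rw [Finset.mem_Icc]; omega, by simp⟩
    · intro u _
      exact le_antisymm (hg _ _ (by simp)) (hg _ _ (by simp))
  have habs : ∀ t : ℤ, ∑ u ∈ Finset.Icc (|t| - M) (|t| + M), g u =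
      ∑ u ∈ Finset.Icc (t - M) (t + M), g u := by
    intro t
    rcases abs_choice t with h | h <;> rw [h]
    exact hneg t
  have hstep : ∀ t : ℤ, 0 ≤ t → ∑ u ∈ Finset.Icc (t + 1 - M) (t + 1 + M), g u ≤
      ∑ u ∈ Finset.Icc (t - M) (t + M), g u := by
    intro t ht
    have h1 : t + 1 + (M : ℤ) = (t + 1 - M) + (2 * M : ℕ) := by push_cast; ring
    have h2 : t + (M : ℤ) = (t - M) + (2 * M : ℕ) := by push_cast; ring
    rw [h1, h2, sum_Icc_eq_sum_range, sum_Icc_eq_sum_range, Finset.sum_range_succ,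
      Finset.sum_range_succ']
    refine add_le_add (le_of_eq (Finset.sum_congr rfl fun i _ => ?_)) (hg _ _ ?_)
    · congr 1
      push_cast
      ring
    · rw [abs_le, abs_of_nonneg (by omega)]
      push_cast
      omega
  rw [← habs s, ← habs t]
  obtain ⟨n, hn⟩ := Int.le.dest hst
  rw [← hn]
  clear hn
  induction n with
  | zero => simp
  | succ n ih =>
    refine le_trans ?_ ih
    have := hstep (|s| + n) (by positivity)
    rwa [add_assoc] at this

lemma rootCount_le_of_abs_le (d M k : ℕ) (s t : ℤ) (hst : |s| ≤ |t|) :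
    rootCount d M k t ≤ rootCount d M k s := by
  induction k generalizing s t with
  | zero =>
    simp only [rootCount]
    split_ifs with h1 h2 h2
    · rfl
    · subst h1
      simp at hst
      exact absurd hst h2
    · exact Nat.zero_le _
    · rfl
  | succ k ih => exact Nat.pow_le_pow_left (sum_Icc_le_of_abs_le ih hst) d

/-- One step of the recursion: exponential decay of `g` yields decay of its window sums. -/
lemma sum_Icc_add_le_mul_sum_Icc {M : ℕ} (hM : 1 ≤ M) {α β : ℝ} (hα0 : 0 < α) (hα1 : α < 1)
    (hβ : β ^ 2 = α) (hβ1 : β ≤ 1)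
    (h : M * (1 + α) + (1 - α + α ^ 2) ≤ β * (2 * M + 1)) {g : ℤ → ℝ} (hg0 : ∀ t, 0 ≤ g t)
    (hg : ∀ s t : ℤ, |s| ≤ |t| → g t ≤ g s) (hdecay : ∀ t : ℤ, 1 ≤ t → g (t + M) ≤ α * g t)
    {t : ℤ} (ht : 1 ≤ t) :
    ∑ s ∈ Finset.Icc (t + M - M) (t + M + M), g s ≤
      β * ∑ s ∈ Finset.Icc (t - M) (t + M), g s := by
  set S := ∑ i ∈ Finset.range M, g (t + i) with hS
  have hA : ∑ s ∈ Finset.Icc (t + M - M) (t + M + M), g s ≤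
      (1 + α) * S - α * g t + (1 + α) * g (t + M) := by
    have e1 : t + (M : ℤ) - M = t := by ring
    have e2 : t + (M : ℤ) + M = t + (M + M : ℕ) := by push_cast; ring
    rw [e1, e2, sum_Icc_eq_sum_range, add_assoc, Finset.sum_range_add, ← hS]
    have hle : ∑ i ∈ Finset.range M, g (t + ((M + (i + 1) : ℕ) : ℤ)) ≤
        α * ∑ i ∈ Finset.range M, g (t + ((i + 1 : ℕ) : ℤ)) := by
      rw [Finset.mul_sum]
      refine Finset.sum_le_sum fun i _ => ?_
      have e : t + ((M + (i + 1) : ℕ) : ℤ) = t + ((i + 1 : ℕ) : ℤ) + M := by push_cast; ring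
      rw [e]
      exact hdecay _ (by omega)
    have hshift : ∑ i ∈ Finset.range M, g (t + ((i + 1 : ℕ) : ℤ)) = S + g (t + M) - g t := by
      have h1 := Finset.sum_range_succ (fun i : ℕ => g (t + (i : ℤ))) M
      rw [Finset.sum_range_succ'] at h1
      simp only [Nat.cast_zero, add_zero] at h1
      linarith
    rw [hshift] at hle
    rw [Finset.sum_range_succ']
    simp only [add_zero]
    nlinarith
  have hB : 2 * S + g (t + M) ≤ ∑ s ∈ Finset.Icc (t - M) (t + M), g s := by
    have e : t + (M : ℤ) = (t - M) + (M + M : ℕ) := by push_cast; ring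
    conv_rhs => rw [e]
    rw [sum_Icc_eq_sum_range, Finset.sum_range_succ, Finset.sum_range_add, ← e]
    have h1 : ∑ i ∈ Finset.range M, g (t - M + ((M + i : ℕ) : ℤ)) = S :=
      Finset.sum_congr rfl fun i _ => by congr 1; push_cast; ring
    have h2 : S ≤ ∑ i ∈ Finset.range M, g (t - M + (i : ℤ)) := by
      rw [← Finset.sum_range_reflect]
      refine Finset.sum_le_sum fun i hi => hg _ _ ?_
      rw [Finset.mem_range] at hi
      rw [abs_le, abs_of_nonneg (by omega : 0 ≤ t + (i : ℤ))]
      omega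
    linarith
  have hSle : S ≤ M * g t := by
    have := Finset.sum_le_card_nsmul (Finset.range M) (fun i : ℕ => g (t + (i : ℤ))) (g t)
      fun i _ => hg _ _ (by rw [abs_of_nonneg, abs_of_nonneg] <;> omega)
    simpa using this
  have hy := hdecay t ht
  have hβ0 : 0 ≤ β := by
    have : (0 : ℝ) < 2 * M + 1 := by positivity
    by_contra! hneg
    have h3 : 0 ≤ M * (1 + α) + (1 - α + α ^ 2) := by nlinarith [(Nat.cast_nonneg M : (0 : ℝ) ≤ M)]
    nlinarith
  refine hA.trans (le_trans ?_ (mul_le_mul_of_nonneg_left hB hβ0))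
  have k1 : 0 ≤ (1 - β) ^ 2 * (M * g t - S) := mul_nonneg (sq_nonneg _) (by linarith)
  have k2 : 0 ≤ (1 + α - β) * (α * g t - g (t + M)) :=
    mul_nonneg (by linarith) (by linarith)
  have k3 : 0 ≤ g t * (β * (2 * M + 1) - (M * (1 + α) + (1 - α + α ^ 2))) :=
    mul_nonneg (hg0 t) (by linarith)
  have k4 : 0 ≤ g t * ((1 - α) * (1 - β)) :=
    mul_nonneg (hg0 t) (mul_nonneg (by linarith) (by linarith))
  have e : (1 - β) ^ 2 = 1 + α - 2 * β := by rw [← hβ]; ring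
  rw [e] at k1
  linarith

/-- **Exponential decay for `d = 2` with any admissible constant `α`.**
If `α ∈ (0,1)` satisfies `((1 + α + (1 - α + α²)/M) / (2 + 1/M))^d ≤ α`, then
for all `k, t ≥ 1`, `G(t+M,k) ≤ α * G(t,k)`. -/
theorem G_exp_decay_with_alpha (d M : ℕ) (hd : d = 2) (hM : 1 ≤ M) (α : ℝ)
    (hα0 : 0 < α) (hα1 : α < 1)
    (hα : ((1 + α + (1 - α + α ^ 2) / (M : ℝ)) / (2 + 1 / (M : ℝ))) ^ d ≤ α)
    (k : ℕ) (hk : 1 ≤ k) (t : ℤ) (ht : 1 ≤ t) :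
    (G d k M (t + M) : ℝ) ≤ α * (G d k M t : ℝ) := by
  subst hd
  have hM0 : (0 : ℝ) < M := by exact_mod_cast hM
  have hβ : √α ^ 2 = α := Real.sq_sqrt hα0.le
  have hβ1 : √α ≤ 1 := Real.sqrt_le_one.mpr hα1.le
  have h : M * (1 + α) + (1 - α + α ^ 2) ≤ √α * (2 * M + 1) := by
    have h1 := Real.le_sqrt_of_sq_le hα
    rw [div_le_iff₀ (by positivity)] at h1
    have h2 := mul_le_mul_of_nonneg_left h1 hM0.le
    have e1 : (M : ℝ) * (1 + α + (1 - α + α ^ 2) / M) = M * (1 + α) + (1 - α + α ^ 2) := by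
      field_simp
    have e2 : (M : ℝ) * (√α * (2 + 1 / M)) = √α * (2 * M + 1) := by
      field_simp
    rwa [e1, e2] at h2
  clear hk
  simp only [G_eq_rootCount]
  induction k generalizing t with
  | zero =>
    have h0 : t + (M : ℤ) ≠ 0 := by omega
    simp only [rootCount, h0, if_false, Nat.cast_zero]
    positivity
  | succ k ih =>
    simp only [rootCount, Nat.cast_pow, Nat.cast_sum]
    have hstep := sum_Icc_add_le_mul_sum_Icc hM hα0 hα1 hβ hβ1 h
      (g := fun s => (rootCount 2 M k s : ℝ)) (fun _ => Nat.cast_nonneg _)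
      (fun s t hst => Nat.cast_le.mpr (rootCount_le_of_abs_le 2 M k s t hst)) ih ht
    calc _ ≤ _ := pow_le_pow_left₀ (by positivity) hstep 2
      _ = _ := by rw [mul_pow, hβ]
end
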